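/- Let N ≥ 1 and let μ : Fin N → ℝ satisfy μ j ≥ 0 for all j, and assume μ is not constant. Let d be the number of indices j attaining max_j μ j, and define J(s) = sup { Σ_j μ j * λ j : λ ∈ Δ_N, H(λ) ≥ s }. Then J is strictly decreasing on the interval [log d, log N]: for all s₁, s₂ with log d ≤ s₁ < s₂ ≤ log N one has J(s₂) < J(s₁). -/

import Mathlib

open scoped Classical

/-- Gibbs' inequality against the uniform distribution: a probability vector supported on `s` has
Shannon entropy at most `log #s`. -/
theorem sum_negMulLog_le_log_card {ι : Type*} [Fintype ι] {s : Finset ι} (hs : s.Nonempty)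
    {p : ι → ℝ} (hp : p ∈ stdSimplex ℝ ι) (hsupp : ∀ j ∉ s, p j = 0) :
    ∑ j, Real.negMulLog (p j) ≤ Real.log s.card := by
  have hc : (0 : ℝ) < s.card := by exact_mod_cast hs.card_pos
  have hsum : ∑ j ∈ s, p j = 1 := by
    rw [← hp.2]
    exact Finset.sum_subset s.subset_univ fun j _ hj => hsupp j hj
  have key : ∀ x : ℝ, 0 ≤ x →
      Real.negMulLog x ≤ x * Real.log s.card + ((s.card : ℝ)⁻¹ - x) := by
    intro x hx
    rcases hx.eq_or_lt with rfl | hx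
    · simp
    · have h := mul_le_mul_of_nonneg_left
        (Real.log_le_sub_one_of_pos (inv_pos.2 (mul_pos hc hx))) hx.le
      rw [Real.log_inv, Real.log_mul hc.ne' hx.ne'] at h
      have h' : x * (((s.card : ℝ) * x)⁻¹ - 1) = (s.card : ℝ)⁻¹ - x := by field_simp
      rw [Real.negMulLog]
      linarith
  calc ∑ j, Real.negMulLog (p j) = ∑ j ∈ s, Real.negMulLog (p j) :=
        (Finset.sum_subset s.subset_univ fun j _ hj => by simp [hsupp j hj]).symm
    _ ≤ ∑ j ∈ s, (p j * Real.log s.card + ((s.card : ℝ)⁻¹ - p j)) :=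
        Finset.sum_le_sum fun j _ => key _ (hp.1 j)
    _ = Real.log s.card := by
        rw [Finset.sum_add_distrib, Finset.sum_sub_distrib, ← Finset.sum_mul, hsum,
          Finset.sum_const, nsmul_eq_mul, mul_inv_cancel₀ hc.ne']
        ring

theorem continuous_sum_negMulLog {ι : Type*} [Fintype ι] :
    Continuous fun p : ι → ℝ => ∑ j, Real.negMulLog (p j) := by
  fun_prop

/-- A linear functional attains its maximum over the probability vectors with entropy at least
`s`, as soon as `s` is at most the entropy of the uniform distribution. -/
theorem exists_isMaxOn_stdSimplex_negMulLog {ι : Type*} [Fintype ι] [Nonempty ι] (c : ι → ℝ)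
    {s : ℝ} (hs : s ≤ Real.log (Fintype.card ι)) :
    ∃ p ∈ stdSimplex ℝ ι ∩ {p | s ≤ ∑ j, Real.negMulLog (p j)},
      IsMaxOn (fun p => ∑ j, c j * p j)
        (stdSimplex ℝ ι ∩ {p | s ≤ ∑ j, Real.negMulLog (p j)}) p := by
  have hcard : (Fintype.card ι : ℝ) ≠ 0 := by exact_mod_cast Fintype.card_ne_zero
  refine ((isCompact_stdSimplex ℝ ι).inter_right
    (isClosed_le continuous_const continuous_sum_negMulLog)).exists_isMaxOn
    ⟨fun _ => (Fintype.card ι : ℝ)⁻¹, ⟨fun _ => by positivity, ?_⟩, ?_⟩ (by fun_prop)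
  · simp [hcard]
  · simpa [Real.negMulLog, Real.log_inv, hcard] using hs

/-- If the weight function `c` is bounded by `c k`, then every probability vector whose entropy
exceeds both `t` and the logarithm of the number of maximizers of `c` can be perturbed, within
entropy at least `t`, so as to increase the mean of `c`. -/
theorem exists_entropy_ge_sum_mul_lt {ι : Type*} [Fintype ι] [DecidableEq ι] {c : ι → ℝ} {k : ι}
    (hk : ∀ j, c j ≤ c k) {p : ι → ℝ} (hp : p ∈ stdSimplex ℝ ι) {t : ℝ}
    (ht : t < ∑ j, Real.negMulLog (p j))
    (hcard : Real.log (Finset.univ.filter fun j => c j = c k).card <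
      ∑ j, Real.negMulLog (p j)) :
    ∃ q ∈ stdSimplex ℝ ι, t ≤ ∑ j, Real.negMulLog (q j) ∧
      ∑ j, c j * p j < ∑ j, c j * q j := by
  have hlt : ∑ j, c j * p j < c k := by
    by_contra! h
    refine hcard.not_ge (sum_negMulLog_le_log_card ⟨k, by simp⟩ hp fun j hj => ?_)
    have hnonneg : ∀ j ∈ Finset.univ, 0 ≤ (c k - c j) * p j := fun j _ =>
      mul_nonneg (sub_nonneg.2 (hk j)) (hp.1 j)
    have hzero : ∑ j, (c k - c j) * p j = 0 := by
      refine le_antisymm ?_ (Finset.sum_nonneg hnonneg)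
      simp only [sub_mul, Finset.sum_sub_distrib, ← Finset.mul_sum, hp.2]
      linarith
    have hj0 := (Finset.sum_eq_zero_iff_of_nonneg hnonneg).1 hzero j (Finset.mem_univ j)
    refine (mul_eq_zero.1 hj0).resolve_left fun h0 => hj ?_
    simp only [Finset.mem_filter, Finset.mem_univ, true_and]
    linarith
  let q : ℝ → ι → ℝ := fun ε => AffineMap.lineMap p (Pi.single k 1) ε
  have hcont : Continuous fun ε => ∑ j, Real.negMulLog (q ε j) :=
    continuous_sum_negMulLog.comp AffineMap.lineMap_continuous
  have hev : ∀ᶠ ε in nhdsWithin (0 : ℝ) (Set.Ioi 0),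
      t < ∑ j, Real.negMulLog (q ε j) :=
    nhdsWithin_le_nhds (hcont.tendsto 0 |>.eventually_const_lt (by simpa [q] using ht))
  obtain ⟨ε, hε, hε0, hε1⟩ := (hev.and (Ioo_mem_nhdsGT one_pos)).exists
  refine ⟨q ε, (convex_stdSimplex ℝ ι).lineMap_mem hp (single_mem_stdSimplex ℝ k)
    ⟨hε0.le, hε1.le⟩, hε.le, ?_⟩
  have hq : ∑ j, c j * q ε j = ∑ j, c j * p j + ε * (c k - ∑ j, c j * p j) := by
    have hj : ∀ j, c j * q ε j =
        (1 - ε) * (c j * p j) + ε * (c j * (Pi.single k 1 : ι → ℝ) j) := fun j => by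
      simp only [q, AffineMap.lineMap_apply_module, Pi.add_apply, Pi.smul_apply, smul_eq_mul]
      ring
    simp only [hj, Finset.sum_add_distrib, ← Finset.mul_sum]
    simp [Pi.single_apply]
    ring
  rw [hq]
  exact lt_add_of_pos_right _ (mul_pos hε0 (sub_pos.2 hlt))

/-- strict monotonicity of the maximal privacy energy
`J(s) = sup { Σ_j μ j * λ j : λ ∈ Δ_N, H(λ) ≥ s }` on `[log d, log N]`
(Theorem 4). -/
theorem stmt3 (N : ℕ) (hN : 1 ≤ N) (μ : Fin N → ℝ) (hμ : ∀ j, 0 ≤ μ j)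
    (hnc : ∃ i j, μ i ≠ μ j)
    (μmax : ℝ) (hmax : IsGreatest (Set.range μ) μmax)
    (d : ℕ) (hd : d = (Finset.univ.filter (fun j => μ j = μmax)).card) :
    ∀ s₁ s₂ : ℝ, Real.log d ≤ s₁ → s₁ < s₂ → s₂ ≤ Real.log N →
      sSup {x : ℝ | ∃ lam : Fin N → ℝ, (∀ j, 0 ≤ lam j) ∧ (∑ j, lam j) = 1 ∧
          s₂ ≤ (∑ j, Real.negMulLog (lam j)) ∧ x = ∑ j, μ j * lam j} <
      sSup {x : ℝ | ∃ lam : Fin N → ℝ, (∀ j, 0 ≤ lam j) ∧ (∑ j, lam j) = 1 ∧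
          s₁ ≤ (∑ j, Real.negMulLog (lam j)) ∧ x = ∑ j, μ j * lam j} := by
  intro s₁ s₂ hds h12 hs2
  obtain ⟨⟨k, rfl⟩, hub⟩ := hmax
  have hk : ∀ j, μ j ≤ μ k := fun j => hub ⟨j, rfl⟩
  have : Nonempty (Fin N) := ⟨k⟩
  obtain ⟨p, ⟨hp, hps⟩, hpmax⟩ :=
    exists_isMaxOn_stdSimplex_negMulLog μ (s := s₂) (by simpa using hs2)
  have h1 : s₁ < ∑ j, Real.negMulLog (p j) := h12.trans_le hps
  subst hd
  obtain ⟨q, hq, hqs, hpq⟩ := exists_entropy_ge_sum_mul_lt hk hp h1 (hds.trans_lt h1)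
  calc _ ≤ ∑ j, μ j * p j := by
        refine csSup_le ⟨_, p, hp.1, hp.2, hps, rfl⟩ ?_
        rintro x ⟨r, hr0, hr1, hrs, rfl⟩
        exact hpmax ⟨⟨hr0, hr1⟩, hrs⟩
    _ < ∑ j, μ j * q j := hpq
    _ ≤ _ := by
        refine le_csSup ⟨μ k, ?_⟩ ⟨q, hq.1, hq.2, hqs, rfl⟩
        rintro x ⟨r, hr0, hr1, -, rfl⟩
        calc ∑ j, μ j * r j ≤ ∑ j, μ k * r j :=
              Finset.sum_le_sum fun j _ => mul_le_mul_of_nonneg_right (hk j) (hr0 j)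
          _ = μ k := by rw [← Finset.mul_sum, hr1, mul_one]
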